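/- arXiv:0911.4025 — 2 statements merged into one kernel-verified Lean document; each statement's English description precedes it below -/
import Mathlib

section
/- The only solution (x,y,z,w) ∈ 𝔽₁₁⁴ of the system x²+y²+z²+w² = 0 and x³+y³+z³+w³ = 0 is (0,0,0,0). Equivalently, the projective curve C over 𝔽₁₁ defined by these two equations has no 𝔽₁₁-rational points. -/
theorem sum_cubes_add_one_ne_zero_of_sum_squares_add_one_eq_zero :
    ∀ x y z : ZMod 11, x * x + y * y + z * z + 1 = 0 →
      x * x * x + y * y * y + z * z * z + 1 ≠ 0 := by
  decide +kernel

theorem eq_zero_of_sum_squares_of_sum_cubes {x y z w : ZMod 11}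
    (h₂ : x ^ 2 + y ^ 2 + z ^ 2 + w ^ 2 = 0) (h₃ : x ^ 3 + y ^ 3 + z ^ 3 + w ^ 3 = 0) :
    w = 0 := by
  have : Fact (Nat.Prime 11) := ⟨by norm_num⟩
  by_contra hw
  refine sum_cubes_add_one_ne_zero_of_sum_squares_add_one_eq_zero (x / w) (y / w) (z / w) ?_ ?_
  · field_simp
    linear_combination h₂
  · field_simp
    linear_combination h₃

/-- The only solution in `𝔽₁₁⁴` of `x²+y²+z²+w² = 0`,
`x³+y³+z³+w³ = 0` is `(0,0,0,0)`; equivalently, the projective curve `C` over `𝔽₁₁`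
defined by these equations has no `𝔽₁₁`-rational points. -/
theorem stmt_14 (x y z w : ZMod 11)
    (e1 : x ^ 2 + y ^ 2 + z ^ 2 + w ^ 2 = 0)
    (e2 : x ^ 3 + y ^ 3 + z ^ 3 + w ^ 3 = 0) :
    (x, y, z, w) = (0, 0, 0, 0) := by
  have hw : w = 0 := eq_zero_of_sum_squares_of_sum_cubes e1 e2
  have hz : z = 0 := eq_zero_of_sum_squares_of_sum_cubes (x := x) (y := y) (z := w)
    (by linear_combination e1) (by linear_combination e2)
  have hy : y = 0 := eq_zero_of_sum_squares_of_sum_cubes (x := x) (y := z) (z := w)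
    (by linear_combination e1) (by linear_combination e2)
  have hx : x = 0 := eq_zero_of_sum_squares_of_sum_cubes (x := y) (y := z) (z := w)
    (by linear_combination e1) (by linear_combination e2)
  rw [hx, hy, hz, hw]
end

section
/- The number of solutions (x,y,z,w) ∈ 𝔽₇₁⁴ of the system x²+y²+z²+w² = 0 and x³+y³+z³+w³ = 0 is exactly 9241; equivalently, the projective curve C over 𝔽₇₁ defined by these two equations has exactly 132 rational points, so that C attains defect 4 from the Hasse–Weil–Serre upper bound 71 + 1 + 4·⌊2√71⌋ = 136 for genus 4 curves over 𝔽₇₁. -/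
/-- In a field, the cuspidal cubic `a ^ 3 = b ^ 2` is parametrized by `t ↦ (t ^ 2, t ^ 3)`. -/
theorem exists_sq_eq_and_cube_eq_iff {F : Type*} [Field F] {a b : F} :
    (∃ t : F, t ^ 2 = a ∧ t ^ 3 = b) ↔ a ^ 3 = b ^ 2 := by
  constructor
  · rintro ⟨t, rfl, rfl⟩
    ring
  · intro h
    by_cases ha : a = 0
    · subst ha
      have hb : b = 0 := by simpa using h.symm
      exact ⟨0, by simp, by simp [hb]⟩
    · refine ⟨b / a, ?_, ?_⟩
      · rw [div_pow, ← h]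
        field_simp
      · rw [div_pow, h, pow_succ b 2]
        have hb : b ≠ 0 := by
          rintro rfl
          exact ha (by simpa using h)
        field_simp

/-- The parametrization `t ↦ (t ^ 2, t ^ 3)` of the cuspidal cubic is injective. -/
theorem eq_of_sq_eq_of_cube_eq {F : Type*} [Field F] {s t : F}
    (h2 : s ^ 2 = t ^ 2) (h3 : s ^ 3 = t ^ 3) : s = t := by
  by_cases ht : t = 0
  · subst ht
    simpa using h2
  · have h : t ^ 2 * s = t ^ 2 * t := by
      rw [← h2, ← pow_succ, h3, h2, ← pow_succ]
    exact mul_left_cancel₀ (pow_ne_zero 2 ht) h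

/-- The plane sextic obtained by eliminating the last variable from the equations
`x² + y² + z² + w² = 0` and `x³ + y³ + z³ + w³ = 0`. -/
def sextic {F : Type*} [CommRing F] (x y z : F) : F :=
  (x ^ 2 + y ^ 2 + z ^ 2) ^ 3 + (x ^ 3 + y ^ 3 + z ^ 3) ^ 2

theorem exists_power_sums_eq_zero_iff {F : Type*} [Field F] {x y z : F} :
    (∃ w : F, x ^ 2 + y ^ 2 + z ^ 2 + w ^ 2 = 0 ∧ x ^ 3 + y ^ 3 + z ^ 3 + w ^ 3 = 0) ↔
      sextic x y z = 0 := by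
  have h := exists_sq_eq_and_cube_eq_iff (a := -(x ^ 2 + y ^ 2 + z ^ 2))
    (b := -(x ^ 3 + y ^ 3 + z ^ 3))
  simp only [eq_neg_iff_add_eq_zero, add_comm (_ ^ _) (_ + _)] at h
  rw [h, sextic]
  constructor
  · intro h
    linear_combination -h
  · intro h
    linear_combination -h

theorem sextic_mul {F : Type*} [CommRing F] (c x y z : F) :
    sextic (c * x) (c * y) (c * z) = c ^ 6 * sextic x y z := by
  unfold sextic
  ring

/-- The number of zeros of the sextic with first coordinate `x`. -/
def sexticSlice {F : Type*} [CommRing F] [Fintype F] [DecidableEq F] (x : F) : ℕ :=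
  ∑ y : F, ∑ z : F, if sextic x y z = 0 then 1 else 0

theorem sexticSlice_eq_one {F : Type*} [Field F] [Fintype F] [DecidableEq F] {x : F}
    (hx : x ≠ 0) : sexticSlice x = sexticSlice (1 : F) := by
  unfold sexticSlice
  symm
  refine Fintype.sum_equiv (Equiv.mulLeft₀ x hx) _ _ fun y => ?_
  refine Fintype.sum_equiv (Equiv.mulLeft₀ x hx) _ _ fun z => ?_
  have h := sextic_mul x 1 y z
  rw [mul_one] at h
  simp [h, hx]

theorem ncard_power_sums_eq_zero {F : Type*} [Field F] [Fintype F] [DecidableEq F] :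
    {v : F × F × F × F |
        v.1 ^ 2 + v.2.1 ^ 2 + v.2.2.1 ^ 2 + v.2.2.2 ^ 2 = 0 ∧
        v.1 ^ 3 + v.2.1 ^ 3 + v.2.2.1 ^ 3 + v.2.2.2 ^ 3 = 0}.ncard =
      sexticSlice (0 : F) + (Fintype.card F - 1) * sexticSlice (1 : F) := by
  have hinj : Set.InjOn (fun v : F × F × F × F => (v.1, v.2.1, v.2.2.1))
      {v : F × F × F × F |
        v.1 ^ 2 + v.2.1 ^ 2 + v.2.2.1 ^ 2 + v.2.2.2 ^ 2 = 0 ∧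
        v.1 ^ 3 + v.2.1 ^ 3 + v.2.2.1 ^ 3 + v.2.2.2 ^ 3 = 0} := by
    rintro ⟨x, y, z, s⟩ ⟨hs2, hs3⟩ ⟨x', y', z', t⟩ ⟨ht2, ht3⟩ h
    simp only [Prod.mk.injEq] at h
    obtain ⟨rfl, rfl, rfl⟩ := h
    rw [eq_of_sq_eq_of_cube_eq (s := s) (t := t) (add_left_cancel (hs2.trans ht2.symm))
      (add_left_cancel (hs3.trans ht3.symm))]
  have himage : (fun v : F × F × F × F => (v.1, v.2.1, v.2.2.1)) ''
      {v : F × F × F × F |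
        v.1 ^ 2 + v.2.1 ^ 2 + v.2.2.1 ^ 2 + v.2.2.2 ^ 2 = 0 ∧
        v.1 ^ 3 + v.2.1 ^ 3 + v.2.2.1 ^ 3 + v.2.2.2 ^ 3 = 0} =
      ((Finset.univ.filter fun p : F × F × F => sextic p.1 p.2.1 p.2.2 = 0 :
        Finset (F × F × F)) : Set (F × F × F)) := by
    ext ⟨x, y, z⟩
    simp only [Finset.coe_filter, Finset.mem_univ, true_and, Set.mem_ofPred_eq,
      ← exists_power_sums_eq_zero_iff]
    constructor
    · rintro ⟨⟨x', y', z', w⟩, hw, h⟩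
      simp only [Prod.mk.injEq] at h
      obtain ⟨rfl, rfl, rfl⟩ := h
      exact ⟨w, hw⟩
    · rintro ⟨w, hw⟩
      exact ⟨(x, y, z, w), hw, rfl⟩
  rw [← hinj.ncard_image, himage, Set.ncard_coe_finset, Finset.card_filter,
    Fintype.sum_prod_type]
  simp only [Fintype.sum_prod_type]
  change ∑ x : F, sexticSlice x = _
  rw [← Finset.add_sum_erase _ _ (Finset.mem_univ (0 : F)),
    Finset.sum_congr rfl fun x hx => sexticSlice_eq_one (Finset.ne_of_mem_erase hx)]
  simp [Finset.card_erase_of_mem]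

theorem floor_two_mul_sqrt : ⌊2 * Real.sqrt 71⌋ = 16 := by
  rw [Int.floor_eq_iff]
  have h := Real.sq_sqrt (show (0 : ℝ) ≤ 71 by norm_num)
  have h0 := Real.sqrt_nonneg 71
  constructor
  · push_cast
    nlinarith
  · push_cast
    nlinarith

theorem sum_zmod_eq_sum_range {M : Type*} [AddCommMonoid M] (n : ℕ) [NeZero n]
    (f : ZMod n → M) : ∑ a : ZMod n, f a = ∑ i ∈ Finset.range n, f (i : ZMod n) := by
  symm
  refine Finset.sum_bij' (fun i _ => (i : ZMod n)) (fun a _ => a.val) ?_ ?_ ?_ ?_ ?_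
  · simp
  · intro a _
    exact Finset.mem_range.mpr a.val_lt
  · intro i hi
    exact ZMod.val_cast_of_lt (Finset.mem_range.mp hi)
  · intro a _
    exact ZMod.natCast_zmod_val a
  · simp

theorem sexticSlice_natCast (n : ℕ) [NeZero n] (x : ℕ) :
    sexticSlice (x : ZMod n) = ∑ y ∈ Finset.range n, ∑ z ∈ Finset.range n,
      if ((x ^ 2 + y ^ 2 + z ^ 2) ^ 3 + (x ^ 3 + y ^ 3 + z ^ 3) ^ 2) % n = 0 then 1 else 0 := by
  unfold sexticSlice
  simp only [sum_zmod_eq_sum_range]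
  refine Finset.sum_congr rfl fun y _ => Finset.sum_congr rfl fun z _ => if_congr ?_ rfl rfl
  rw [← Nat.dvd_iff_mod_eq_zero, ← ZMod.natCast_eq_zero_iff]
  simp [sextic]

theorem sexticSlice_zero : sexticSlice (0 : ZMod 71) = 1 := by
  rw [← Nat.cast_zero, sexticSlice_natCast]
  decide +kernel

theorem sexticSlice_one : sexticSlice (1 : ZMod 71) = 132 := by
  rw [← Nat.cast_one, sexticSlice_natCast]
  decide +kernel

/-- The system `x²+y²+z²+w² = 0`, `x³+y³+z³+w³ = 0` has exactly
`9241` solutions in `𝔽₇₁⁴`; equivalently the projective curve `C` over `𝔽₇₁` has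
exactly `132` rational points (each projective point gives `71 − 1 = 70` nonzero
affine solutions and `(0,0,0,0)` is always a solution, so `9241 = 132·70 + 1`), so
that `C` attains defect `4` from the Hasse–Weil–Serre upper bound
`71 + 1 + 4·⌊2√71⌋ = 136` for genus `4` curves over `𝔽₇₁`. -/
theorem stmt_18 :
    {v : ZMod 71 × ZMod 71 × ZMod 71 × ZMod 71 |
        v.1 ^ 2 + v.2.1 ^ 2 + v.2.2.1 ^ 2 + v.2.2.2 ^ 2 = 0 ∧
        v.1 ^ 3 + v.2.1 ^ 3 + v.2.2.1 ^ 3 + v.2.2.2 ^ 3 = 0}.ncard = 9241 ∧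
    9241 = 132 * (71 - 1) + 1 ∧
    (71 + 1 + 4 * ⌊2 * Real.sqrt 71⌋ : ℤ) = 136 ∧
    (136 - 132 : ℤ) = 4 := by
  have : Fact (Nat.Prime 71) := ⟨by norm_num⟩
  refine ⟨?_, by norm_num, by rw [floor_two_mul_sqrt]; norm_num, by norm_num⟩
  refine (ncard_power_sums_eq_zero (F := ZMod 71)).trans ?_
  rw [ZMod.card]
  exact congrArg₂ (fun a b => a + (71 - 1) * b) sexticSlice_zero sexticSlice_one
end
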